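/- arXiv:2401.11583 — 4 statements merged into one kernel-verified Lean document; each statement's English description precedes it below -/
import Mathlib

section
/- Let F be a finite field of odd cardinality q with q ≡ 3 (mod 4), and let H be the subgroup of SL_2(F) whose underlying set is UC(F) = { [[x, y], [-y, x]] : x, y ∈ F, x² + y² = 1 }. Then H is cyclic of order q + 1. -/
theorem unitCircle_isCyclic_aux (F : Type*) [Field F] [Fintype F] (h2 : (2 : F) ≠ 0)
    (H : Subgroup (Matrix.SpecialLinearGroup (Fin 2) F))
    (hH : ∀ A : Matrix.SpecialLinearGroup (Fin 2) F,
      A ∈ H ↔ ∃ x y : F, x ^ 2 + y ^ 2 = 1 ∧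
        (A : Matrix (Fin 2) (Fin 2) F) = !![x, y; -y, x]) : IsCyclic H := by
  classical
  obtain ⟨i, hi⟩ := IsAlgClosed.exists_pow_nat_eq (-1 : AlgebraicClosure F) (n := 2) (by norm_num)
  let a := algebraMap F (AlgebraicClosure F)
  have h2' : (2 : AlgebraicClosure F) ≠ 0 := by
    have : a 2 ≠ 0 := (map_ne_zero a).2 h2
    rwa [map_ofNat] at this
  let f : H →* AlgebraicClosure F :=
    { toFun := fun A => a (A.1.1 0 0) + a (A.1.1 0 1) * i
      map_one' := by simp
      map_mul' := by
        rintro ⟨A, hA⟩ ⟨B, hB⟩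
        obtain ⟨x, y, h, e⟩ := (hH A).1 hA
        obtain ⟨z, w, h', e'⟩ := (hH B).1 hB
        simp [e, e', Matrix.mul_apply, Fin.sum_univ_two]
        linear_combination (- a y * a w) * hi }
  have : Finite (Matrix.SpecialLinearGroup (Fin 2) F) := by
    unfold Matrix.SpecialLinearGroup; infer_instance
  refine isCyclic_of_injective_ringHom f ((injective_iff_map_eq_one f).2 ?_)
  rintro ⟨A, hA⟩ hf
  obtain ⟨x, y, h, e⟩ := (hH A).1 hA
  have hf' : a x + a y * i = 1 := by simpa [f, e] using hf
  have hn : a x ^ 2 + a y ^ 2 = 1 := by simpa using congrArg a h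
  have h3 : a x - a y * i = 1 := by
    linear_combination hn - (a x - a y * i) * hf' - (a y)^2 * hi
  have hx : a x = 1 := mul_left_cancel₀ h2' (by linear_combination hf' + h3)
  have hy : a y = 0 := by
    have : a y ^ 2 = 0 := by rw [hx] at hn; linear_combination hn
    exact pow_eq_zero_iff (two_ne_zero) |>.1 this
  have hx' : x = 1 := a.injective (by simpa using hx)
  have hy' : y = 0 := (map_eq_zero a).1 hy
  subst hx' hy'
  apply Subtype.ext
  apply Subtype.ext
  change A.1 = 1
  rw [e, Matrix.one_fin_two]; simp

theorem unitCircle_card_aux (F : Type*) [Field F] [Fintype F]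
    (hs : ∀ t : F, 1 + t ^ 2 ≠ 0) (h2 : (2 : F) ≠ 0)
    (H : Subgroup (Matrix.SpecialLinearGroup (Fin 2) F))
    (hH : ∀ A : Matrix.SpecialLinearGroup (Fin 2) F,
      A ∈ H ↔ ∃ x y : F, x ^ 2 + y ^ 2 = 1 ∧
        (A : Matrix (Fin 2) (Fin 2) F) = !![x, y; -y, x]) :
    Nat.card H = Fintype.card F + 1 := by
  classical
  let m : ∀ x y : F, x ^ 2 + y ^ 2 = 1 → H := fun x y h =>
    ⟨⟨!![x, y; -y, x], by rw [Matrix.det_fin_two_of]; linear_combination h⟩,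
      (hH _).2 ⟨x, y, h, rfl⟩⟩
  have minj : ∀ x y h z w h', m x y h = m z w h' → x = z ∧ y = w := by
    intro x y h z w h' e
    have e1 : !![x, y; -y, x] = !![z, w; -w, z] := congrArg (fun A : H => A.1.1) e
    exact ⟨by simpa using congrFun (congrFun e1 0) 0, by simpa using congrFun (congrFun e1 0) 1⟩
  have hp0 : (-1 : F) ^ 2 + 0 ^ 2 = 1 := by ring
  have hpt : ∀ t : F, ((1 - t ^ 2) / (1 + t ^ 2)) ^ 2 + (2 * t / (1 + t ^ 2)) ^ 2 = 1 := by
    intro t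
    have := hs t
    field_simp
    ring
  let g : Option F → H := fun o => match o with
    | none => m (-1) 0 hp0
    | some t => m ((1 - t ^ 2) / (1 + t ^ 2)) (2 * t / (1 + t ^ 2)) (hpt t)
  have key : ∀ t : F, 1 + (1 - t ^ 2) / (1 + t ^ 2) = 2 / (1 + t ^ 2) := by
    intro t
    have := hs t
    field_simp
    ring
  have hne : ∀ t : F, (1 - t ^ 2) / (1 + t ^ 2) ≠ -1 := by
    intro t h
    have h1 := key t
    rw [h] at h1
    have : (2 : F) / (1 + t ^ 2) ≠ 0 := div_ne_zero h2 (hs t)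
    exact this (by rw [← h1]; ring)
  have hg : Function.Bijective g := by
    constructor
    · rintro (_ | t) (_ | s) e
      · rfl
      · exact absurd (minj _ _ hp0 _ _ (hpt s) e).1.symm (hne s)
      · exact absurd (minj _ _ (hpt t) _ _ hp0 e).1 (hne t)
      · obtain ⟨e1, e2⟩ := minj _ _ (hpt t) _ _ (hpt s) e
        have k : (2 : F) / (1 + t ^ 2) = 2 / (1 + s ^ 2) := by rw [← key, ← key, e1]
        have k' : (2 : F) / (1 + t ^ 2) ≠ 0 := div_ne_zero h2 (hs t)
        have : t = s := by
          apply mul_left_cancel₀ k'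
          calc (2 : F) / (1 + t ^ 2) * t = 2 * t / (1 + t ^ 2) := by ring
            _ = 2 * s / (1 + s ^ 2) := e2
            _ = 2 / (1 + s ^ 2) * s := by ring
            _ = _ := by rw [k]
        rw [this]
    · rintro ⟨A, hA⟩
      obtain ⟨x, y, h, e⟩ := (hH A).1 hA
      have hm : (⟨A, hA⟩ : H) = m x y h := Subtype.ext (Subtype.ext e)
      rw [hm]
      have mc : ∀ z w h', z = x → w = y → m z w h' = m x y h := by
        rintro z w h' rfl rfl; rfl
      by_cases hx : 1 + x = 0
      · have hx' : x = -1 := by linear_combination hx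
        refine ⟨none, mc _ _ hp0 hx'.symm ?_⟩
        have : y ^ 2 = 0 := by rw [hx'] at h; linear_combination h
        exact (pow_eq_zero_iff two_ne_zero |>.1 this).symm
      · have hq : 1 + (y / (1 + x)) ^ 2 = 2 / (1 + x) := by
          field_simp
          linear_combination h
        have hq' : 1 - (y / (1 + x)) ^ 2 = 2 * x / (1 + x) := by
          field_simp
          linear_combination -h
        refine ⟨some (y / (1 + x)), mc _ _ (hpt _) ?_ ?_⟩
        · rw [hq, hq']; field_simp
        · rw [hq]; field_simp
  rw [← Nat.card_eq_of_bijective g hg, Nat.card_eq_fintype_card, Fintype.card_option]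

/-- Let `F` be a finite field of odd cardinality `q` with `q ≡ 3 (mod 4)`, and let
`H` be the subgroup of `SL₂(F)` whose underlying set is the unit circle
`UC(F) = { [[x, y], [-y, x]] : x² + y² = 1 }`. Then `H` is cyclic of order `q + 1`. -/
theorem unitCircle_cyclic_card_q_add_one (F : Type*) [Field F] [Fintype F]
    (hodd : Odd (Fintype.card F)) (h4 : Fintype.card F % 4 = 3)
    (H : Subgroup (Matrix.SpecialLinearGroup (Fin 2) F))
    (hH : ∀ A : Matrix.SpecialLinearGroup (Fin 2) F,
      A ∈ H ↔ ∃ x y : F, x ^ 2 + y ^ 2 = 1 ∧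
        (A : Matrix (Fin 2) (Fin 2) F) = !![x, y; -y, x]) :
    IsCyclic H ∧ Nat.card H = Fintype.card F + 1 := by
  have hs : ∀ t : F, 1 + t ^ 2 ≠ 0 := by
    intro t ht
    exact FiniteField.isSquare_neg_one_iff.1 ⟨t, by linear_combination -ht⟩ h4
  have h2 : (2 : F) ≠ 0 := fun h => hs 1 (by linear_combination h)
  exact ⟨unitCircle_isCyclic_aux F h2 H hH, unitCircle_card_aux F hs h2 H hH⟩
end

section
/- Let F be a finite field whose cardinality q is odd and satisfies q ≡ 1 (mod 8) or q ≡ -1 (mod 8). Then there is no unital ring R of characteristic zero whose group of units R^× is isomorphic to SL_2(F). -/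
universe u

/-- In a ring of characteristic zero, a square root of two gives a unit of infinite order. -/
lemma pell_pow {R : Type u} [Ring R] (s : R) (hs : s * s = 2) (n : ℕ) :
    ∃ a b : ℤ, 0 < a ∧ 0 < b ∧ (1 + s) ^ (n + 1) = (a : R) + (b : R) * s := by
  induction n with
  | zero => exact ⟨1, 1, by norm_num, by norm_num, by simp⟩
  | succ n ih =>
    obtain ⟨a, b, ha, hb, h⟩ := ih
    refine ⟨a + 2 * b, a + b, by positivity, by positivity, ?_⟩
    rw [pow_succ, h]
    have h2 : ((a : R) + (b : R) * s) * (1 + s) = a + b * s + a * s + b * (s * s) := by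
      noncomm_ring
    rw [h2, hs]
    push_cast
    have h3 : (b : R) * 2 = 2 * b := by rw [mul_two, two_mul]
    rw [h3]
    noncomm_ring

lemma no_sqrt_two {R : Type u} [Ring R] [CharZero R] [Finite Rˣ] (s : R) (hs : s * s = 2) :
    False := by
  have h1 : (1 + s) * (s - 1) = 1 := by
    have : (1 + s) * (s - 1) = s * s - 1 := by noncomm_ring
    rw [this, hs]; norm_num
  have h2 : (s - 1) * (1 + s) = 1 := by
    have : (s - 1) * (1 + s) = s * s - 1 := by noncomm_ring
    rw [this, hs]; norm_num
  let v : Rˣ := ⟨1 + s, s - 1, h1, h2⟩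
  obtain ⟨n, hn, hv⟩ := (isOfFinOrder_of_finite v).exists_pow_eq_one
  obtain ⟨m, rfl⟩ : ∃ m, n = m + 1 := ⟨n - 1, by omega⟩
  have hv' : (1 + s) ^ (m + 1) = 1 := by
    have := congrArg Units.val hv
    simpa [v] using this
  obtain ⟨a, b, ha, hb, h⟩ := pell_pow s hs m
  rw [hv'] at h
  have h3 : (b : R) * s = ((1 - a : ℤ) : R) := by
    push_cast
    rw [eq_sub_iff_add_eq, add_comm, ← h]
  have h4 : ((b * b * 2 : ℤ) : R) = (((1 - a) * (1 - a) : ℤ) : R) := by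
    have hc : (b : R) * s * (b * s) = b * b * (s * s) := by
      rw [mul_assoc, ← mul_assoc s, ← (Int.cast_commute b s).eq]
      simp only [mul_assoc]
    rw [Int.cast_mul (1 - a), ← h3, hc, hs]
    push_cast
    rfl
  have h5 : b * b * 2 = (1 - a) * (1 - a) := by exact_mod_cast h4
  have hirr := irrational_sqrt_two
  apply (irrational_iff_ne_rational _).1 hirr |(1 - a)| b (by omega)
  have hbR : (0 : ℝ) < b := by exact_mod_cast hb
  have h6 : (b : ℝ) * b * 2 = (1 - a) * (1 - a) := by exact_mod_cast h5
  rw [Real.sqrt_eq_iff_mul_self_eq (by norm_num) (by positivity)]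
  push_cast
  rw [div_mul_div_comm, abs_mul_abs_self, ← h6]
  field_simp

/-- Let `F` be a finite field of odd cardinality `q` with `q ≡ ±1 (mod 8)`.
Then there is no unital ring of characteristic zero whose group of units is
isomorphic to `SL₂(F)`. -/
theorem sl2_pm_one_mod_eight_not_realizable_char_zero (F : Type*) [Field F] [Fintype F]
    (hodd : Odd (Fintype.card F))
    (h8 : (Fintype.card F : ZMod 8) = 1 ∨ (Fintype.card F : ZMod 8) = -1) :
    ∀ (R : Type u) [Ring R] [CharZero R],
      ¬ Nonempty (Rˣ ≃* Matrix.SpecialLinearGroup (Fin 2) F) := by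
  classical
  rintro R _ _ ⟨e⟩
  have : Finite Rˣ := Finite.of_equiv _ e.symm.toEquiv
  have hF2 : ringChar F ≠ 2 := by
    intro h
    have := FiniteField.even_card_of_char_two h
    rw [Nat.odd_iff] at hodd
    omega
  have h20 : (2 : F) ≠ 0 := Ring.two_ne_zero hF2
  have hsq : IsSquare (2 : F) := by
    rw [FiniteField.isSquare_two_iff]
    have h8' : Fintype.card F % 8 = 1 ∨ Fintype.card F % 8 = 7 := by
      rcases h8 with h | h
      · left
        have : ((Fintype.card F : ℕ) : ZMod 8) = ((1 : ℕ) : ZMod 8) := by simpa using h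
        exact (ZMod.natCast_eq_natCast_iff' _ _ _).1 this
      · right
        have : ((Fintype.card F : ℕ) : ZMod 8) = ((7 : ℕ) : ZMod 8) := by rw [h]; decide
        exact (ZMod.natCast_eq_natCast_iff' _ _ _).1 this
    omega
  obtain ⟨r, hr⟩ := hsq
  let A : Matrix.SpecialLinearGroup (Fin 2) F := ⟨!![0, -1; 1, r], by simp [Matrix.det_fin_two]⟩
  have hA : A ^ 4 = -1 := by
    apply Subtype.ext
    have : (A ^ 4).1 = (!![0, -1; 1, r] : Matrix (Fin 2) (Fin 2) F) ^ 4 := rfl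
    rw [this]
    ext i j
    fin_cases i <;> fin_cases j <;> simp [pow_succ, Matrix.mul_apply, Fin.sum_univ_two] <;> grind
  have hneg : e (-1) = -1 := by
    have hB : e (-1) * e (-1) = 1 := by rw [← map_mul]; simp
    have hB1 : e (-1) ≠ 1 := by
      intro h
      have h' : (-1 : Rˣ) = 1 := by simpa using h
      have h'' : (-1 : R) = 1 := by simpa using congrArg Units.val h'
      have : ((-1 : ℤ) : R) = ((1 : ℤ) : R) := by simpa using h''
      have := Int.cast_injective this
      omega
    generalize e (-1) = B at hB hB1
    have hinv : B = B⁻¹ := eq_inv_of_mul_eq_one_left hB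
    have hd := B.2
    rw [Matrix.det_fin_two] at hd
    have hM : B.1 = Matrix.adjugate B.1 := by
      conv_lhs => rw [hinv]
      rfl
    rw [Matrix.adjugate_fin_two] at hM
    have h00 := congrFun (congrFun hM 0) 0
    have h01 := congrFun (congrFun hM 0) 1
    have h10 := congrFun (congrFun hM 1) 0
    simp at h00 h01 h10 hd
    have e01 : B.1 0 1 = 0 := by grind
    have e10 : B.1 1 0 = 0 := by grind
    have hsq1 : B.1 1 1 * B.1 1 1 = 1 := by grind
    rcases mul_self_eq_one_iff.1 hsq1 with h | h
    · exfalso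
      apply hB1
      apply Subtype.ext
      ext i j
      fin_cases i <;> fin_cases j <;> simp <;> grind
    · apply Subtype.ext
      ext i j
      fin_cases i <;> fin_cases j <;> simp <;> grind
  have hx : (e.symm A) ^ 4 = -1 := by
    rw [← map_pow, hA, ← hneg, MulEquiv.symm_apply_apply]
  have hxR : ((e.symm A : Rˣ) : R) ^ 4 = -1 := by
    simpa using congrArg Units.val hx
  generalize ((e.symm A : Rˣ) : R) = x at hxR
  apply no_sqrt_two (x - x ^ 3)
  have h6 : x ^ 6 = - x ^ 2 := by
    rw [show 6 = 4 + 2 from rfl, pow_add, hxR]; simp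
  have : (x - x ^ 3) * (x - x ^ 3) = x ^ 2 - 2 * x ^ 4 + x ^ 6 := by noncomm_ring
  rw [this, hxR, h6]
  simp
end

section
/- Let n be a positive integer, and suppose there exists a finite unital ring R with trivial Jacobson radical whose group of units R^× is isomorphic either to Hol(Z_n) or to C_2 × Hol(Z_n), where C_2 is the cyclic group of order 2. Then n divides 6. -/
/-- The holomorph `Hol(Z_n) = Z_n ⋊ Aut(Z_n) ≅ AGL₁(Z_n)` of the additive cyclic
group `Z_n`, realized concretely as pairs `(a, b)` with `a : ZMod n` and
`b : (ZMod n)ˣ`, with multiplication `(a, b) * (c, d) = (a + b * c, b * d)`. -/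
@[ext] structure Hol (n : ℕ) where
  a : ZMod n
  b : (ZMod n)ˣ

namespace Hol

variable {n : ℕ}

instance instGroup : Group (Hol n) where
  mul x y := ⟨x.a + (x.b : ZMod n) * y.a, x.b * y.b⟩
  one := ⟨0, 1⟩
  inv x := ⟨-(((x.b⁻¹ : (ZMod n)ˣ) : ZMod n) * x.a), x.b⁻¹⟩
  mul_assoc x y z := by
    refine Hol.ext ?_ ?_
    · show x.a + (x.b : ZMod n) * y.a + ((x.b * y.b : (ZMod n)ˣ) : ZMod n) * z.a
        = x.a + (x.b : ZMod n) * (y.a + (y.b : ZMod n) * z.a)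
      push_cast
      ring
    · exact mul_assoc x.b y.b z.b
  one_mul x := by
    refine Hol.ext ?_ ?_
    · show (0 : ZMod n) + ((1 : (ZMod n)ˣ) : ZMod n) * x.a = x.a
      simp
    · exact one_mul x.b
  mul_one x := by
    refine Hol.ext ?_ ?_
    · show x.a + (x.b : ZMod n) * 0 = x.a
      simp
    · exact mul_one x.b
  inv_mul_cancel x := by
    refine Hol.ext ?_ ?_
    · show -(((x.b⁻¹ : (ZMod n)ˣ) : ZMod n) * x.a) + ((x.b⁻¹ : (ZMod n)ˣ) : ZMod n) * x.a = 0
      simp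
    · exact inv_mul_cancel x.b

@[simp] lemma mul_a (x y : Hol n) : (x * y).a = x.a + (x.b : ZMod n) * y.a := rfl
@[simp] lemma mul_b (x y : Hol n) : (x * y).b = x.b * y.b := rfl
@[simp] lemma one_a : (1 : Hol n).a = 0 := rfl
@[simp] lemma one_b : (1 : Hol n).b = 1 := rfl

/-- The translation subgroup `Z_n × {1}` of `Hol(Z_n)`, the image of the canonical
embedding of `Z_n`. -/
def trans (n : ℕ) : Subgroup (Hol n) where
  carrier := {x | x.b = 1}
  one_mem' := rfl
  mul_mem' := by
    intro x y hx hy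
    show (x * y).b = 1
    simp only [mul_b]
    rw [show x.b = 1 from hx, show y.b = 1 from hy, mul_one]
  inv_mem' := by
    intro x hx
    show x.b⁻¹ = 1
    rw [show x.b = 1 from hx, inv_one]

@[simp] lemma mem_trans (x : Hol n) : x ∈ trans n ↔ x.b = 1 := Iff.rfl

end Hol

universe u

/-- Key linear-algebra lemma. -/
lemma key_end {F V : Type*} [Field F] [AddCommGroup V] [Module F V]
    (t s s' : Module.End F V) (hs : s' * s = 1) (hts : t * s * t = s)
    (H : ∀ g g' : Module.End F V, g * g' = 1 → g' * g = 1 → ∃ m : ℕ, g * t = t ^ m * g) :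
    t ^ 6 = 1 := by
  by_cases hsc : ∀ v : V, ¬ LinearIndependent F ![v, t v]
  · obtain ⟨a, ha⟩ := LinearMap.exists_eq_smul_id_of_forall_notLinearIndependent hsc
    have h1 : s * (t * t) = s := by
      conv_rhs => rw [← hts]
      rw [ha]
      ext x
      simp
    have h2 : t * t = 1 := by
      calc t * t = s' * s * (t * t) := by rw [hs, one_mul]
        _ = s' * (s * (t * t)) := by rw [mul_assoc]
        _ = 1 := by rw [h1, hs]
    calc t ^ 6 = (t * t) ^ 3 := by rw [← pow_two, ← pow_mul]
      _ = 1 := by rw [h2, one_pow]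
  push Not at hsc
  obtain ⟨v, hv⟩ := hsc
  have hpair : ∀ a b : F, a • v + b • t v = 0 → a = 0 ∧ b = 0 :=
    LinearIndependent.pair_iff.1 hv
  have hv0 : v ≠ 0 := by
    intro h0
    have := hpair 1 0 (by simp [h0])
    simp at this
  have hinj : ∀ x, t x = 0 → x = 0 := by
    intro x hx
    have h1 : s x = 0 := by
      rw [← hts]; simp [hx]
    have h2 : (s' * s) x = 0 := by simp [h1]
    simpa [hs] using h2
  have htv : t v ∉ Submodule.span F {v} := by
    intro h
    obtain ⟨c, hc⟩ := Submodule.mem_span_singleton.1 h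
    have := hpair c (-1) (by simp [hc])
    simp at this
  obtain ⟨f, hf0, hf1⟩ := LinearMap.exists_extend_of_notMem
    (0 : Submodule.span F {v} →ₗ[F] F) htv 1
  have hfv : f v = 0 := by
    have := LinearMap.congr_fun hf0 ⟨v, Submodule.mem_span_singleton_self v⟩
    simpa using this
  -- transvections
  have Htr : ∀ (φ : V →ₗ[F] F) (z : V), φ z = 0 → φ v = 0 → ∃ m : ℕ,
      (1 + φ.smulRight z) * t = t ^ m * (1 + φ.smulRight z) ∧
      (t ^ m) v = t v + φ (t v) • z := by
    intro φ z hz hφv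
    have hE : φ.smulRight z * φ.smulRight z = (0 : Module.End F V) := by
      ext x
      simp [hz]
    obtain ⟨m, hm⟩ := H (1 + φ.smulRight z) (1 - φ.smulRight z)
      (by rw [mul_sub, mul_one, add_mul, hE]; simp)
      (by rw [mul_add, mul_one, sub_mul, hE]; simp)
    refine ⟨m, hm, ?_⟩
    have := LinearMap.congr_fun hm v
    simpa [hφv] using this.symm
  -- `v` is a separating vector for the commutant of `t`
  have hsep : ∀ h : Module.End F V, Commute h t → h v = 0 → h = 0 := by
    intro h hc hhv
    have hpow : ∀ m : ℕ, h ((t ^ m) v) = 0 := by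
      intro m
      have := LinearMap.congr_fun (hc.pow_right m).eq v
      simpa [hhv] using this
    have h1 : h (t v) = 0 := by simpa using hpow 1
    have hK : ∀ z, f z = 0 → h z = 0 := by
      intro z hz
      obtain ⟨m, -, hm⟩ := Htr f z hz hfv
      have := hpow m
      rw [hm, hf1, one_smul, map_add, h1, zero_add] at this
      exact this
    ext x
    have := hK (x - f x • t v) (by simp [hf1])
    simpa [h1] using this
  -- `v` and `t v` span
  have hspan : ∀ x, x ∈ Submodule.span F {v, t v} := by
    by_contra! hx
    obtain ⟨x, hx⟩ := hx
    obtain ⟨φ, hφ0, hφ1⟩ := LinearMap.exists_extend_of_notMem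
      (0 : Submodule.span F {v, t v} →ₗ[F] F) hx 1
    have hφv : φ v = 0 := by
      have := LinearMap.congr_fun hφ0 ⟨v, Submodule.subset_span (by simp)⟩
      simpa using this
    have hφtv : φ (t v) = 0 := by
      have := LinearMap.congr_fun hφ0 ⟨t v, Submodule.subset_span (by simp)⟩
      simpa using this
    obtain ⟨m, hm, hmv⟩ := Htr φ v hφv hφv
    have htm : t ^ m - t = 0 :=
      hsep _ (((Commute.refl t).pow_left m).sub_left (Commute.refl t)) (by simp [hmv, hφtv])
    rw [sub_eq_zero.1 htm] at hm
    have hz : φ.smulRight v = (0 : Module.End F V) := by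
      apply hsep
      · have : (φ.smulRight v : Module.End F V) * t = t * φ.smulRight v := by
          simpa [add_mul, mul_add] using hm
        exact this
      · simp [hφv]
    have := LinearMap.congr_fun hz x
    simp [hφ1, hv0] at this
  obtain ⟨b, a, hab⟩ := Submodule.mem_span_pair.1 (hspan (t (t v)))
  have hquad : t * t = a • t + b • 1 := by
    have : t * t - (a • t + b • 1) = 0 := by
      apply hsep
      · apply Commute.sub_left
        · exact (Commute.refl t).mul_left (Commute.refl t)
        · exact ((Commute.refl t).smul_left a).add_left ((Commute.one_left t).smul_left b)
      · simp [← hab, add_comm]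
    exact sub_eq_zero.1 this
  have hc : ∀ c : F, c * c - a * c = 0 ∧ c + c = 0 := by
    intro c
    obtain ⟨m, hm, hmv⟩ := Htr f (c • v) (by simp [hfv]) hfv
    rw [hf1, one_smul] at hmv
    have hT : t ^ m = t + c • 1 := by
      have : t ^ m - (t + c • 1) = 0 := by
        apply hsep
        · apply Commute.sub_left
          · exact (Commute.refl t).pow_left m
          · exact (Commute.refl t).add_left ((Commute.one_left t).smul_left c)
        · simp [hmv]
      exact sub_eq_zero.1 this
    rw [hT] at hm
    set g : Module.End F V := 1 + f.smulRight (c • v) with hg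
    have hgv : g v = v := by simp [hg, hfv]
    have h1 : g * (t * t) = (t + c • 1) * (t + c • 1) * g := by
      rw [← mul_assoc, hm, mul_assoc, hm, mul_assoc]
    have h2 : g * (t * t) = a • ((t + c • 1) * g) + b • g := by
      rw [hquad, mul_add, mul_smul_comm, hm, mul_smul_comm, mul_one]
    have h3 := LinearMap.congr_fun (h1.symm.trans h2) v
    simp only [Module.End.mul_apply, hgv, LinearMap.add_apply, LinearMap.smul_apply,
      Module.End.one_apply, map_add, map_smul] at h3
    rw [← hab] at h3
    apply hpair
    have h4 := sub_eq_zero.2 h3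
    rw [← h4]
    module
  have ha : a = 1 := by
    have := (hc 1).1
    linear_combination -this
  have h2 : (1 : F) + 1 = 0 := (hc 1).2
  have hb : b = 1 := by
    have hb0 : b ≠ 0 := by
      intro hb0
      have h1 : t (t v - v) = 0 := by
        rw [map_sub, ← hab, ha, hb0]; simp
      have h3 := hinj _ h1
      have := hpair (-1) 1 (by rw [← h3]; module)
      simp at this
    have h1 : b * (b - 1) = 0 := by
      have := (hc b).1
      rw [ha] at this
      linear_combination this
    rcases mul_eq_zero.1 h1 with h | h
    · exact absurd h hb0
    · exact sub_eq_zero.1 h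
  rw [ha, hb, one_smul, one_smul] at hquad
  have htt : t + t = 0 := by
    rw [← two_smul F t, ← one_add_one_eq_two, h2, zero_smul]
  have h3 : t ^ 3 = 1 := by
    rw [pow_succ, pow_two, hquad, add_mul, hquad, one_mul, add_right_comm, htt, zero_add]
  calc t ^ 6 = (t ^ 3) ^ 2 := by rw [← pow_mul]
    _ = 1 := by rw [h3, one_pow]

/-- Transfer of the key lemma to finite rings with trivial Jacobson radical. -/
lemma key_ring {R : Type*} [Ring R] [Finite R] (hJ : (⊥ : Ideal R).jacobson = ⊥)
    (t s s' : R) (hs : s' * s = 1) (hts : t * s * t = s)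
    (H : ∀ g g' : R, g * g' = 1 → g' * g = 1 → ∃ m : ℕ, g * t = t ^ m * g) :
    t ^ 6 = 1 := by
  have : IsSemisimpleRing R := by
    rw [IsArtinianRing.isSemisimpleRing_iff_jacobson, ← Ideal.jacobson_bot, hJ]
  obtain ⟨k, D, d, _, hd, ⟨e⟩⟩ :=
    IsSemisimpleRing.exists_ringEquiv_pi_matrix_divisionRing R
  have hfin : ∀ i, Finite (D i) := by
    intro i
    have : Finite (∀ i, Matrix (Fin (d i)) (Fin (d i)) (D i)) := Finite.of_equiv _ e.toEquiv
    have h0 : Function.Surjective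
        (fun x : (∀ i, Matrix (Fin (d i)) (Fin (d i)) (D i)) => x i 0 0) := by
      intro y
      exact ⟨fun j => if h : j = i then h ▸ Matrix.of fun _ _ => y else 0, by simp⟩
    exact Finite.of_surjective _ h0
  apply e.injective
  rw [map_pow, map_one]
  funext i
  have φ : Matrix (Fin (d i)) (Fin (d i)) (D i) ≃+* Module.End (D i) (Fin (d i) → D i) :=
    (Matrix.toLinAlgEquiv' (R := D i) (n := Fin (d i))).toRingEquiv
  apply φ.injective
  rw [Pi.pow_apply, Pi.one_apply, map_pow, map_one]
  apply key_end (φ (e t i)) (φ (e s i)) (φ (e s' i))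
  · rw [← map_mul, ← Pi.mul_apply, ← map_mul, hs]; simp
  · rw [← map_mul, ← map_mul, ← Pi.mul_apply, ← Pi.mul_apply, ← map_mul, ← map_mul, hts]
  · intro g g' h h'
    obtain ⟨m, hm⟩ := H (e.symm (Pi.mulSingle i (φ.symm g))) (e.symm (Pi.mulSingle i (φ.symm g')))
      (by rw [← map_mul, ← Pi.mulSingle_mul, ← map_mul, h]; simp)
      (by rw [← map_mul, ← Pi.mulSingle_mul, ← map_mul, h']; simp)
    refine ⟨m, ?_⟩
    have := congrArg (fun x => φ (e x i)) hm
    simpa using this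

lemma Hol.tpow (n : ℕ) (m : ℕ) : (⟨1, 1⟩ : Hol n) ^ m = ⟨(m : ZMod n), 1⟩ := by
  induction m with
  | zero => simp; rfl
  | succ m ih => rw [pow_succ, ih]; ext <;> simp

/-- Group-level version. -/
lemma key_group {R : Type*} [Ring R] [Finite R] (hJ : (⊥ : Ideal R).jacobson = ⊥)
    {G : Type*} [Group G] (e : Rˣ ≃* G) (t s : G) (hts : t * s * t = s)
    (H : ∀ g : G, ∃ m : ℕ, g * t = t ^ m * g) : t ^ 6 = 1 := by
  have h : ((e.symm t : Rˣ) : R) ^ 6 = 1 := by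
    apply key_ring hJ _ ((e.symm s : Rˣ) : R) ((e.symm s)⁻¹ : Rˣ)
    · simp
    · rw [← Units.val_mul, ← Units.val_mul, ← map_mul, ← map_mul, hts]
    · intro g g' h h'
      obtain ⟨m, hm⟩ := H (e ⟨g, g', h, h'⟩)
      refine ⟨m, ?_⟩
      have := congrArg (fun x => ((e.symm x : Rˣ) : R)) hm
      simpa using this
  have h2 : (e.symm t) ^ 6 = 1 := by
    ext; simpa using h
  have := congrArg e h2
  simpa using this

/-- Let `n` be a positive integer. If there is a finite unital ring `R` with
trivial Jacobson radical whose unit group is isomorphic to `Hol(Z_n)` or to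
`C₂ × Hol(Z_n)`, then `n` divides 6. -/
theorem hol_jacobson_trivial (n : ℕ) (hn : 0 < n)
    (R : Type u) [Ring R] [Finite R] (hJ : (⊥ : Ideal R).jacobson = ⊥)
    (h : Nonempty (Rˣ ≃* Hol n) ∨
      Nonempty (Rˣ ≃* Multiplicative (ZMod 2) × Hol n)) :
    n ∣ 6 := by
  have : NeZero n := ⟨hn.ne'⟩
  have hT : ∀ g : Hol n, ∃ m : ℕ, g * ⟨1, 1⟩ = (⟨1, 1⟩ : Hol n) ^ m * g := by
    intro g
    refine ⟨(g.b : ZMod n).val, ?_⟩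
    rw [Hol.tpow]
    ext <;> simp [add_comm]
  have hS : (⟨1, 1⟩ : Hol n) * ⟨0, -1⟩ * ⟨1, 1⟩ = ⟨0, -1⟩ := by
    ext <;> simp
  have h6 : (⟨1, 1⟩ : Hol n) ^ 6 = 1 := by
    rcases h with ⟨⟨e⟩⟩ | ⟨⟨e⟩⟩
    · exact key_group hJ e _ ⟨0, -1⟩ hS hT
    · have := key_group hJ e (1, ⟨1, 1⟩) (1, ⟨0, -1⟩) (by ext1 <;> simp [hS]) (by
        intro g
        obtain ⟨m, hm⟩ := hT g.2
        exact ⟨m, by ext1 <;> simp [hm]⟩)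
      exact congrArg Prod.snd this
  rw [Hol.tpow] at h6
  have := congrArg Hol.a h6
  exact (ZMod.natCast_eq_zero_iff 6 n).1 this
end

section
/- Let n be a positive integer. If there exists a finite unital ring R of characteristic 2 or of characteristic 4 whose group of units R^× is isomorphic to Hol(Z_n), then n divides 12. Moreover, Hol(Z_1) (the trivial group) and Hol(Z_3) (the symmetric group S_3) are not the group of units of any ring of characteristic 4. -/
universe u


/-- A version of a computation in a commutative ring. -/
lemma comm_five {A : Type*} [CommRing A] (t : A) (h4 : (4 : A) = 0) (h2 : 2 * t = 2)
    (hv : (1 + t + t ^ 2 + t ^ 3 + t ^ 4) ^ 2 = t ^ 4) : t ^ 12 = 1 := by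
  have p2 : 2 * t ^ 2 = 2 := by linear_combination (t + 1) * h2
  have p3 : 2 * t ^ 3 = 2 := by linear_combination t * p2 + h2
  have p6 : 2 * t ^ 6 = 2 := by linear_combination t ^ 3 * p3 + p3
  have p7 : 2 * t ^ 7 = 2 := by linear_combination t * p6 + h2
  have e : (1 + t ^ 2) * (1 + t ^ 6) = 0 := by
    linear_combination hv - h2 - p2 - p6 - p7 - (2 + t ^ 5 + t ^ 4 + t ^ 3) * h4
  linear_combination (1 - t ^ 2 + t ^ 4) * e - p6 - h4

lemma comm_three {A : Type*} [CommRing A] (s : A) (h4 : (4 : A) = 0) (h2 : 2 * s = 2)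
    (hv : (1 + s + s ^ 2) ^ 2 = s ^ 2) : s ^ 8 = 1 := by
  have p2 : 2 * s ^ 2 = 2 := by linear_combination (s + 1) * h2
  have p3 : 2 * s ^ 3 = 2 := by linear_combination s * p2 + h2
  have e : s ^ 4 = 1 := by
    linear_combination hv - h2 - p2 - p3 - 2 * h4
  linear_combination (s ^ 4 + 1) * e

lemma comm_inv_three {A : Type*} [CommRing A] (s : A) (h4 : (4 : A) = 0) (h5 : s ^ 5 = 1) :
    (1 + s + s ^ 2) * (∑ k ∈ Finset.range 7, s ^ (3 * k)) = 1 := by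
  simp only [Finset.sum_range_succ, Finset.sum_range_zero]
  have e : s ^ 10 = 1 := by linear_combination (s ^ 5 + 1) * h5
  have e' : s ^ 15 = 1 := by linear_combination (s ^ 10) * h5 + e
  have e'' : s ^ 20 = 1 := by linear_combination (s ^ 10 + 1) * e
  linear_combination (1 + s + s ^ 2 + s ^ 3 + s ^ 4) * (h5 + e + e' + h4) + e'' - (e'' - e'')

lemma comm_geom_mul {A : Type*} [CommRing A] (t : A) (a r : ℕ) :
    (∑ k ∈ Finset.range a, t ^ k) * (∑ k ∈ Finset.range r, t ^ (a * k)) =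
      ∑ k ∈ Finset.range (a * r), t ^ k := by
  induction r with
  | zero => simp
  | succ r ih =>
    rw [Finset.sum_range_succ, mul_add, ih, Nat.mul_succ, Finset.sum_range_add, Finset.sum_mul]
    congr 1
    exact Finset.sum_congr rfl fun k _ => by ring

lemma comm_inv_five {A : Type*} [CommRing A] (t : A) (h4 : (4 : A) = 0) (n : ℕ) (hn : 0 < n)
    (ht : t ^ n = 1) (hc : Nat.Coprime 5 n) :
    ∃ w : A, (1 + t + t ^ 2 + t ^ 3 + t ^ 4) * w = 1 := by
  have hc' : Nat.Coprime 5 (4 * n) := Nat.Coprime.mul_right (by norm_num) hc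
  obtain ⟨r, -, hr⟩ := Nat.exists_mul_mod_eq_one_of_coprime hc' (by omega)
  refine ⟨∑ k ∈ Finset.range r, t ^ (5 * k), ?_⟩
  have h := comm_geom_mul t 5 r
  have h5 : ∑ k ∈ Finset.range 5, t ^ k = 1 + t + t ^ 2 + t ^ 3 + t ^ 4 := by
    simp [Finset.sum_range_succ]
  rw [h5] at h
  rw [h]
  have hd := Nat.div_add_mod (5 * r) (4 * n)
  rw [hr] at hd
  rw [← hd, Finset.sum_range_succ]
  have e := comm_geom_mul t n (4 * (5 * r / (4 * n)))
  have e2 : n * (4 * (5 * r / (4 * n))) = 4 * n * (5 * r / (4 * n)) := by ring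
  rw [e2] at e
  rw [← e]
  have e3 : ∀ k, t ^ (n * k) = 1 := fun k => by rw [pow_mul, ht, one_pow]
  have e4 : t ^ (4 * n * (5 * r / (4 * n))) = 1 := by rw [← e2, e3]
  rw [e4]
  simp [e3, h4]

/-- The group theoretic part: `R` with `4 = 0` and a unit of order `n` which generates its own
centralizer and is conjugate to its inverse. -/
lemma key_aux {R A : Type*} [Ring R] [CommRing A] (ι : A →+* R) (hι : Function.Injective ι)
    (n : ℕ) (hn : 0 < n) (h4 : (4 : R) = 0) (T : Rˣ) (t : A) (htT : ι t = T)
    (h1 : ∀ u : Rˣ, u * T = T * u → ∃ i : ℕ, u = T ^ i)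
    (hg : ∃ g : Rˣ, g * T * g⁻¹ = T⁻¹)
    (h3 : ∀ k : ℕ, T ^ k = 1 ↔ n ∣ k) : n ∣ 12 := by
  have hA4 : (4 : A) = 0 := hι (by rw [map_ofNat, map_zero, h4])
  have htk : ∀ k : ℕ, t ^ k = 1 ↔ n ∣ k := fun k => by
    rw [← h3, Units.ext_iff, ← hι.eq_iff, map_pow, htT]; simp
  -- units of A are powers of t
  have hpow : ∀ v w : A, v * w = 1 → ∃ i : ℕ, v = t ^ i := by
    intro v w hvw
    have hwv : w * v = 1 := by rw [mul_comm]; exact hvw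
    obtain ⟨i, hi⟩ := h1 ⟨ι v, ι w, by rw [← map_mul, hvw, map_one],
        by rw [← map_mul, hwv, map_one]⟩ (by
      ext
      simp only [Units.val_mul]
      rw [← htT, ← map_mul, ← map_mul, mul_comm])
    refine ⟨i, hι ?_⟩
    rw [map_pow, htT]
    simpa using congrArg Units.val hi
  have h2 : 2 * t = 2 := by
    obtain ⟨i, hi⟩ := hpow (1 + 2 * t) (1 + 2 * t) (by
      linear_combination (t + t ^ 2) * hA4)
    obtain ⟨j, hj⟩ := hpow (-1) (-1) (by ring)
    have hi2 : n ∣ 2 * i := (htk _).1 (by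
      rw [mul_comm, pow_mul, ← hi]; linear_combination (t + t ^ 2) * hA4)
    have hj2 : n ∣ 2 * j := (htk _).1 (by rw [mul_comm, pow_mul, ← hj]; ring)
    have hcase : n ∣ i ∨ n ∣ j ∨ n ∣ i + j := by
      rcases Nat.even_or_odd' n with ⟨h, rfl | rfl⟩
      · obtain ⟨a, ha⟩ := (Nat.mul_dvd_mul_iff_left (by norm_num)).1 hi2
        obtain ⟨b, hb⟩ := (Nat.mul_dvd_mul_iff_left (by norm_num)).1 hj2
        rcases Nat.even_or_odd' a with ⟨c, rfl | rfl⟩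
        · exact Or.inl ⟨c, by rw [ha]; ring⟩
        · rcases Nat.even_or_odd' b with ⟨d, rfl | rfl⟩
          · exact Or.inr (Or.inl ⟨d, by rw [hb]; ring⟩)
          · exact Or.inr (Or.inr ⟨c + d + 1, by rw [ha, hb]; ring⟩)
      · left
        exact Nat.Coprime.dvd_of_dvd_mul_left (by simp) hi2
    rcases hcase with h | h | h
    · rw [(htk _).2 h] at hi
      have : 2 * (2 * t) = 0 := by linear_combination t * hA4
      have hn1 : 2 * t = 0 := by linear_combination hi
      -- multiply by the inverse of t
      have hinv : t ^ (n - 1) * t = 1 := by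
        rw [← pow_succ, Nat.sub_add_cancel hn]; exact (htk _).2 dvd_rfl
      have : (2 : A) = 0 := by linear_combination t ^ (n - 1) * hn1 - 2 * hinv
      rw [hn1, this]
    · rw [(htk _).2 h] at hj
      linear_combination (1 - t) * hj
    · have := (htk _).2 h
      rw [pow_add, ← hi, ← hj] at this
      linear_combination -this - hA4
  -- the symmetry
  obtain ⟨g, hg⟩ := hg
  have hinv1 : t * t ^ (n - 1) = 1 := by
    rw [← pow_succ', Nat.sub_add_cancel hn]; exact (htk _).2 dvd_rfl
  let c : R →+* R :=
    { toFun := fun x => (g : R) * x * ((g⁻¹ : Rˣ) : R)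
      map_one' := by simp
      map_mul' := fun x y => by simp [mul_assoc]
      map_zero' := by simp
      map_add' := fun x y => by simp [mul_add, add_mul] }
  have hct : c (ι t) = ι (t ^ (n - 1)) := by
    have : T⁻¹ = T ^ (n - 1) := by
      rw [inv_eq_iff_mul_eq_one, ← pow_succ', Nat.sub_add_cancel hn]
      exact (h3 _).2 dvd_rfl
    rw [this] at hg
    rw [map_pow, htT]
    change (g : R) * T * ((g⁻¹ : Rˣ) : R) = _
    simpa using congrArg Units.val hg
  have c5 : Nat.Coprime 5 n := by
    rw [Nat.Prime.coprime_iff_not_dvd (by norm_num)]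
    rintro ⟨e, rfl⟩
    set s := t ^ e with hs
    set s' := (t ^ (5 * e - 1)) ^ e with hs'
    have hss : s * s' = 1 := by rw [hs, hs', ← mul_pow, hinv1, one_pow]
    have hs5 : s ^ 5 = 1 := by rw [hs, ← pow_mul, mul_comm]; exact (htk _).2 dvd_rfl
    have hs2 : 2 * s = 2 := by
      rw [hs]
      have : ∀ k : ℕ, 2 * t ^ k = 2 := fun k => by
        induction k with
        | zero => simp
        | succ k ih => rw [pow_succ, ← mul_assoc, ih, h2]
      exact this e
    obtain ⟨i, hi⟩ := hpow _ _ (comm_inv_three s hA4 hs5)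
    have hcs : c (ι s) = ι s' := by
      rw [hs, hs', map_pow, map_pow, hct, ← map_pow]
    have hc : 1 + s' + s' ^ 2 = (t ^ (5 * e - 1)) ^ i := by
      apply hι
      have := congrArg (fun x : A => c (ι x)) hi
      simp only [map_add, map_one,
        map_pow, hct, hcs] at this ⊢
      exact this
    have hv : (1 + s + s ^ 2) ^ 2 = s ^ 2 := by
      have q : (1 + s + s ^ 2) * (1 + s' + s' ^ 2) = 1 := by
        rw [hc, hi, ← mul_pow, hinv1, one_pow]
      linear_combination s ^ 2 * q - (1 + s + s ^ 2) * (s + 1 + s * s') * hss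
    have h8 := comm_three s hA4 hs2 hv
    have : s = 1 := by
      linear_combination (s ^ 8 + 1) * h8 - (s ^ 11 + s ^ 6 + s) * hs5
    rw [hs, htk] at this
    have := Nat.le_of_dvd (by omega) this
    omega
  obtain ⟨w, hw⟩ := comm_inv_five t hA4 n hn ((htk _).2 dvd_rfl) c5
  obtain ⟨i, hi⟩ := hpow _ _ hw
  rw [← htk]
  refine comm_five t hA4 h2 ?_
  set s' := t ^ (n - 1) with hs'
  have hc : 1 + s' + s' ^ 2 + s' ^ 3 + s' ^ 4 = s' ^ i := by
    apply hι
    have := congrArg (fun x : A => c (ι x)) hi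
    simp only [map_add, map_one,
      map_pow, hct] at this ⊢
    exact this
  have q : (1 + t + t ^ 2 + t ^ 3 + t ^ 4) * (1 + s' + s' ^ 2 + s' ^ 3 + s' ^ 4) = 1 := by
    rw [hc, hi, ← mul_pow, hinv1, one_pow]
  have q' : t ^ 4 * (1 + s' + s' ^ 2 + s' ^ 3 + s' ^ 4) = 1 + t + t ^ 2 + t ^ 3 + t ^ 4 := by
    have a2 : t ^ 2 * s' ^ 2 = 1 := by rw [← mul_pow, hinv1, one_pow]
    have a3 : t ^ 3 * s' ^ 3 = 1 := by rw [← mul_pow, hinv1, one_pow]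
    have a4 : t ^ 4 * s' ^ 4 = 1 := by rw [← mul_pow, hinv1, one_pow]
    linear_combination t ^ 3 * hinv1 + t ^ 2 * a2 + t * a3 + a4
  linear_combination t ^ 4 * q - (1 + t + t ^ 2 + t ^ 3 + t ^ 4) * q'

lemma key {R : Type*} [Ring R] (n : ℕ) (hn : 0 < n) (h4 : (4 : R) = 0) (T : Rˣ)
    (h1 : ∀ u : Rˣ, u * T = T * u → ∃ i : ℕ, u = T ^ i)
    (hg : ∃ g : Rˣ, g * T * g⁻¹ = T⁻¹)
    (h3 : ∀ k : ℕ, T ^ k = 1 ↔ n ∣ k) : n ∣ 12 := by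
  have hc : IsMulCommutative (Algebra.adjoin ℤ {(T : R)}) := Algebra.isMulCommutative_adjoin ℤ (by
    rintro a rfl b rfl; rfl)
  exact key_aux (A := Algebra.adjoin ℤ {(T : R)}) (Algebra.adjoin ℤ {(T : R)}).val.toRingHom
    Subtype.val_injective n hn h4 T ⟨T, Algebra.subset_adjoin rfl⟩ rfl h1 hg h3

lemma Hol.pow_trans (n k : ℕ) : ((⟨1, 1⟩ : Hol n)) ^ k = ⟨(k : ZMod n), 1⟩ := by
  induction k with
  | zero => ext <;> simp
  | succ k ih => rw [pow_succ, ih]; ext <;> simp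

/-- If a finite unital ring of characteristic 2 or 4 has unit group isomorphic to
`Hol(Z_n)`, then `n` divides 12. Moreover, `Hol(Z_1)` (the trivial group) and
`Hol(Z_3) ≅ S₃` are not the group of units of any ring of characteristic 4. -/
theorem hol_realizable_char_two_four (n : ℕ) (hn : 0 < n) :
    (∀ (R : Type u) [Ring R] [Finite R], (ringChar R = 2 ∨ ringChar R = 4) →
      Nonempty (Rˣ ≃* Hol n) → n ∣ 12) ∧
    (∀ (R : Type u) [Ring R], ringChar R = 4 →
      ¬ Nonempty (Rˣ ≃* Hol 1) ∧ ¬ Nonempty (Rˣ ≃* Hol 3)) := by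
  constructor
  · rintro R _ _ hR ⟨φ⟩
    have h4 : (4 : R) = 0 := by
      have : ((4 : ℕ) : R) = 0 := (ringChar.spec R 4).2 (by rcases hR with h | h <;> rw [h] <;> norm_num)
      exact_mod_cast this
    haveI : NeZero n := ⟨hn.ne'⟩
    refine key n hn h4 (φ.symm ⟨1, 1⟩) ?_ ?_ ?_
    · intro u hu
      have h := congrArg φ hu
      simp only [map_mul, MulEquiv.apply_symm_apply] at h
      have hb : (φ u).b = 1 := by
        have := congrArg Hol.a h
        simp only [Hol.mul_a, Units.val_one, one_mul, mul_one] at this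
        ext
        rw [Units.val_one]
        exact add_left_cancel (this.trans (add_comm _ _))
      refine ⟨(φ u).a.val, ?_⟩
      apply φ.injective
      rw [map_pow, MulEquiv.apply_symm_apply, Hol.pow_trans]
      ext <;> simp [hb]
    · refine ⟨φ.symm ⟨0, -1⟩, ?_⟩
      rw [mul_inv_eq_iff_eq_mul, eq_inv_mul_iff_mul_eq, ← map_mul, ← map_mul]
      congr 1
      ext <;> simp
    · intro k
      rw [← map_pow, MulEquiv.map_eq_one_iff, Hol.pow_trans, Hol.ext_iff]
      simp [ZMod.natCast_eq_zero_iff]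
  · intro R _ hR
    have h2 : (2 : R) ≠ 0 := by
      intro h
      have := (ringChar.spec R 2).1 (by exact_mod_cast h)
      rw [hR] at this
      revert this; decide
    have hne : (-1 : Rˣ) ≠ 1 := by
      intro h
      apply h2
      have := congrArg Units.val h
      rw [Units.val_neg, Units.val_one] at this
      rw [← one_add_one_eq_two]
      nth_rewrite 1 [← this]
      simp
    constructor
    · rintro ⟨φ⟩
      apply hne
      apply φ.injective
      ext
      · exact Subsingleton.elim (α := ZMod 1) _ _
      · exact Subsingleton.elim (α := ZMod 1) _ _
    · rintro ⟨φ⟩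
      apply hne
      apply φ.injective
      have hc : ∀ y : Hol 3, φ (-1) * y = y * φ (-1) := fun y => by
        obtain ⟨x, rfl⟩ := φ.surjective y
        rw [← map_mul, ← map_mul]; simp
      rw [map_one]
      generalize φ (-1) = z at hc
      have e1 := congrArg Hol.a (hc ⟨1, 1⟩)
      have e2 := congrArg Hol.a (hc ⟨0, -1⟩)
      simp only [Hol.mul_a, Units.val_one, one_mul, mul_one, mul_zero, add_zero, zero_add,
        Units.val_neg] at e1 e2
      have hb : (z.b : ZMod 3) = 1 := add_left_cancel (e1.trans (add_comm _ _))
      have ha : z.a = 0 := by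
        generalize z.a = a at e2
        revert a; decide
      refine Hol.ext ha (Units.ext hb)
end
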